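/- Let d ≥ 3 and A > 0, and define q : ℝ^d → ℝ by q(z) = (max(|z|, A))^{-(d-2)}, where |·| is the Euclidean norm. Let Y be an isotropic random vector in ℝ^d. Then for every z ∈ ℝ^d with |z| ≥ A, one has E[q(z + Y)] ≤ q(z). -/

import Mathlib

open MeasureTheory
open scoped ProbabilityTheory

lemma taylor_aux (k M : ℝ) (hM : k * (k + 1) / 2 < M) :
    ∃ δ > 0, ∀ u : ℝ, |u| < δ → (1 + u) ^ (-k) ≤ 1 - k * u + M * u ^ 2 := by
  let h : ℝ → ℝ := fun u => 1 - k * u + M * u ^ 2 - (1 + u) ^ (-k)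
  have hd : ∀ u : ℝ, -1 < u → HasDerivAt h (- k + 2 * M * u + k * (1 + u) ^ (-k - 1)) u := by
    intro u hu
    have h1 : HasDerivAt (fun u : ℝ => 1 + u) 1 u := by
      simpa using (hasDerivAt_id u).const_add 1
    have h2 := h1.rpow_const (p := -k) (Or.inl (by linarith))
    have h3 : HasDerivAt (fun u : ℝ => k * u) k u := by
      simpa using (hasDerivAt_id u).const_mul k
    have h4 := (hasDerivAt_pow 2 u).const_mul M
    refine (((h3.const_sub 1).add h4).sub h2).congr_deriv ?_
    simp; ring
  have hnear : ∀ᶠ u : ℝ in nhds 0, -1 < u := lt_mem_nhds (by norm_num)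
  have hd1 : deriv h =ᶠ[nhds 0] fun u => - k + 2 * M * u + k * (1 + u) ^ (-k - 1) := by
    filter_upwards [hnear] with u hu using (hd u hu).deriv
  have hd2 : HasDerivAt (fun u : ℝ => - k + 2 * M * u + k * (1 + u) ^ (-k - 1))
      (2 * M - k * (k + 1)) 0 := by
    have h1 : HasDerivAt (fun u : ℝ => 1 + u) 1 0 := by
      simpa using (hasDerivAt_id (0:ℝ)).const_add 1
    have h2 := (h1.rpow_const (p := -k - 1) (Or.inl (by norm_num))).const_mul k
    have h3 : HasDerivAt (fun u : ℝ => 2 * M * u) (2 * M) 0 := by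
      simpa using (hasDerivAt_id (0:ℝ)).const_mul (2 * M)
    refine ((h3.const_add (-k)).add h2).congr_deriv ?_
    simp; ring
  have hmin : IsLocalMin h 0 := by
    apply isLocalMin_of_deriv_deriv_pos
    · rw [hd1.deriv_eq, hd2.deriv]; linarith
    · rw [hd1.eq_of_nhds]; simp
    · exact (hd 0 (by norm_num)).continuousAt
  obtain ⟨δ, hδ, hb⟩ := Metric.eventually_nhds_iff.1 hmin
  refine ⟨δ, hδ, fun u hu => ?_⟩
  have := hb (y := u) (by simpa using hu)
  simp [h] at this
  linarith

/-- the regularised Newtonian kernel -/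
noncomputable def ker (d : ℕ) (k ε : ℝ) (x : EuclideanSpace ℝ (Fin d)) : ℝ :=
  (‖x‖ ^ 2 + ε) ^ (-k)

lemma norm_sq_add_single (d : ℕ) (x : EuclideanSpace ℝ (Fin d)) (i : Fin d) (t : ℝ) :
    ‖x + EuclideanSpace.single i t‖ ^ 2 = ‖x‖ ^ 2 + 2 * t * x i + t ^ 2 := by
  rw [norm_add_sq_real, EuclideanSpace.inner_single_right, EuclideanSpace.norm_single]
  simp; ring

lemma second_diff (d : ℕ) (hd : 3 ≤ d) (k : ℝ) (hk : 2 * k = d - 2) (ε R : ℝ) (hε : 0 < ε)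
    (hR : 0 ≤ R) :
    ∃ t0 > 0, ∀ t : ℝ, 0 < t → t < t0 → ∀ x : EuclideanSpace ℝ (Fin d), ‖x‖ ≤ R →
      ∑ i, (ker d k ε (x + EuclideanSpace.single i t) + ker d k ε (x + EuclideanSpace.single i (-t)))
        < 2 * d * ker d k ε x := by
  have hd' : (3 : ℝ) ≤ d := by exact_mod_cast hd
  have hk0 : 0 < k := by linarith
  set η : ℝ := k * ε / (8 * (R ^ 2 + 1)) with hη
  have hη0 : 0 < η := by positivity
  have hηR : 8 * η * R ^ 2 ≤ k * ε := by
    have : 8 * η * (R ^ 2 + 1) = k * ε := by rw [hη]; field_simp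
    nlinarith
  obtain ⟨M, hM⟩ : ∃ M, M = k * (k + 1) / 2 + η := ⟨_, rfl⟩
  have hM0 : 0 < M := by rw [hM]; positivity
  obtain ⟨δ, hδ, hT⟩ := taylor_aux k M (by linarith)
  have e1 : ∀ᶠ t : ℝ in nhds 0, 2 * d * M * t ^ 2 < k * ε := by
    have : ContinuousAt (fun t : ℝ => 2 * d * M * t ^ 2) 0 := by fun_prop
    exact this.eventually_lt_const (by simp; positivity)
  have e2 : ∀ᶠ t : ℝ in nhds 0, t ^ 2 + 2 * t * R < δ * ε := by
    have : ContinuousAt (fun t : ℝ => t ^ 2 + 2 * t * R) 0 := by fun_prop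
    exact this.eventually_lt_const (by simp; positivity)
  obtain ⟨t0, ht0, hb⟩ := Metric.eventually_nhds_iff.1 (e1.and e2)
  refine ⟨t0, ht0, fun t htp htt x hx => ?_⟩
  obtain ⟨b1, b2⟩ := hb (y := t) (by simpa [abs_of_pos htp] using htt)
  obtain ⟨a, ha⟩ : ∃ a, a = ‖x‖ ^ 2 + ε := ⟨_, rfl⟩
  have hxx : ‖x‖ ^ 2 ≤ R ^ 2 := by gcongr
  have hεa : ε ≤ a := by rw [ha]; nlinarith [sq_nonneg ‖x‖]
  have ha0 : 0 < a := by linarith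
  have key : ∀ (i : Fin d) (s : ℝ), |s| = t → ker d k ε (x + EuclideanSpace.single i s) ≤
      a ^ (-k) * (1 - k * ((2 * s * x i + t ^ 2) / a) + M * ((2 * s * x i + t ^ 2) / a) ^ 2) := by
    intro i s hs
    have hs2 : s ^ 2 = t ^ 2 := by rw [← hs, sq_abs]
    have hxi : |x i| ≤ R := (by simpa using PiLp.norm_apply_le x i : |x i| ≤ ‖x‖).trans hx
    have hu : |(2 * s * x i + t ^ 2) / a| < δ := by
      rw [abs_div, abs_of_pos ha0, div_lt_iff₀ ha0]
      calc |2 * s * x i + t ^ 2| ≤ |2 * s * x i| + |t ^ 2| := abs_add_le _ _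
        _ = 2 * t * |x i| + t ^ 2 := by
          rw [abs_mul, abs_mul, hs, abs_of_nonneg (sq_nonneg t)]; simp
        _ ≤ t ^ 2 + 2 * t * R := by nlinarith
        _ < δ * ε := b2
        _ ≤ δ * a := by gcongr
    have h1 := hT _ hu
    have hpos : 0 ≤ 1 + (2 * s * x i + t ^ 2) / a := by
      have : 0 ≤ ‖x + EuclideanSpace.single i s‖ ^ 2 + ε := by positivity
      rw [norm_sq_add_single, hs2] at this
      have h2 : 1 + (2 * s * x i + t ^ 2) / a = (‖x‖ ^ 2 + 2 * s * x i + t ^ 2 + ε) / a := by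
        rw [ha] at ha0 ⊢; field_simp; ring
      rw [h2]; positivity
    have h3 : ker d k ε (x + EuclideanSpace.single i s) =
        a ^ (-k) * (1 + (2 * s * x i + t ^ 2) / a) ^ (-k) := by
      rw [ker, norm_sq_add_single, hs2, ← Real.mul_rpow ha0.le hpos]
      congr 1
      rw [ha] at ha0 ⊢; field_simp; ring
    rw [h3]
    gcongr
  have hsum : ∑ i, x i ^ 2 = ‖x‖ ^ 2 := (EuclideanSpace.real_norm_sq_eq x).symm
  have hak : 0 < a ^ (-k) := Real.rpow_pos_of_pos ha0 _
  have hker : ker d k ε x = a ^ (-k) := by rw [ker, ha]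
  calc _ ≤ ∑ i : Fin d, a ^ (-k) * ((2 - 2 * k * t ^ 2 / a + 2 * M * t ^ 4 / a ^ 2)
            + 8 * M * t ^ 2 / a ^ 2 * x i ^ 2) := by
        refine Finset.sum_le_sum fun i _ => ?_
        refine (add_le_add (key i t (abs_of_pos htp)) (key i (-t) (by simp [abs_of_pos htp]))).trans_eq ?_
        field_simp; ring
    _ = a ^ (-k) * (d * (2 - 2 * k * t ^ 2 / a + 2 * M * t ^ 4 / a ^ 2)
            + 8 * M * t ^ 2 / a ^ 2 * ‖x‖ ^ 2) := by
        rw [← Finset.mul_sum, Finset.sum_add_distrib, ← Finset.mul_sum, hsum]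
        simp
        left; ring
    _ = a ^ (-k) * (2 * d + t ^ 2 / a ^ 2 * (- 2 * k * d * a + 2 * d * M * t ^ 2 + 8 * M * ‖x‖ ^ 2)) := by
        field_simp; ring
    _ < a ^ (-k) * (2 * d) := by
        have : - 2 * k * d * a + 2 * d * M * t ^ 2 + 8 * M * ‖x‖ ^ 2 < 0 := by
          have hd2 : (d : ℝ) = 2 * k + 2 := by linarith
          have h8 : 8 * η * ‖x‖ ^ 2 ≤ 8 * η * R ^ 2 := by gcongr
          have h9 : - 2 * k * d * a + 8 * M * ‖x‖ ^ 2 = -2 * k * d * ε + 8 * η * ‖x‖ ^ 2 := by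
            rw [ha, hM, hd2]; ring
          have h10 : 3 * (k * ε) ≤ d * (k * ε) := by gcongr
          have : 0 < k * ε := by positivity
          linarith
        have h2 : t ^ 2 / a ^ 2 * (- 2 * k * d * a + 2 * d * M * t ^ 2 + 8 * M * ‖x‖ ^ 2) < 0 :=
          mul_neg_of_pos_of_neg (by positivity) this
        gcongr
        linarith
    _ = _ := by rw [hker]; ring

lemma ker_cont (d : ℕ) (k ε : ℝ) (hε : 0 < ε) : Continuous (ker d k ε) := by
  unfold ker
  refine Continuous.rpow_const (by fun_prop) fun x => Or.inl ?_
  positivity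

lemma ker_nonneg (d : ℕ) (k ε : ℝ) (hε : 0 < ε) (x) : 0 ≤ ker d k ε x := by
  unfold ker; positivity

lemma ker_le (d : ℕ) (k ε : ℝ) (hk : 0 ≤ k) (hε : 0 < ε) (x) : ker d k ε x ≤ ε ^ (-k) := by
  unfold ker
  apply Real.rpow_le_rpow_of_nonpos hε _ (by linarith)
  nlinarith [sq_nonneg ‖x‖]

lemma ker_norm_le (d : ℕ) (k ε : ℝ) (hk : 0 ≤ k) (hε : 0 < ε) (x) : ‖ker d k ε x‖ ≤ ε ^ (-k) := by
  rw [Real.norm_of_nonneg (ker_nonneg d k ε hε x)]; exact ker_le d k ε hk hε x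

lemma ker_integrable (d : ℕ) (k ε : ℝ) (hk : 0 ≤ k) (hε : 0 < ε) {α : Type*} [MeasurableSpace α]
    (μ : Measure α) [IsFiniteMeasure μ] (g : α → EuclideanSpace ℝ (Fin d)) (hg : Measurable g) :
    Integrable (fun a => ker d k ε (g a)) μ := by
  refine Integrable.of_bound (C := ε ^ (-k)) ?_ (Filter.Eventually.of_forall fun a => ker_norm_le d k ε hk hε _)
  exact ((ker_cont d k ε hε).measurable.comp hg).aestronglyMeasurable

lemma exists_iso (d : ℕ) (v w : EuclideanSpace ℝ (Fin d)) (h : ‖v‖ = ‖w‖) :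
    ∃ O : EuclideanSpace ℝ (Fin d) ≃ₗᵢ[ℝ] EuclideanSpace ℝ (Fin d), O v = w :=
  ⟨_, Submodule.reflection_sub h⟩

/-- isotropic probability measure on the sphere -/
lemma exists_sphere (d : ℕ) (hd : 3 ≤ d) (ρ : ℝ) (hρ : 0 ≤ ρ) :
    ∃ ν : Measure (EuclideanSpace ℝ (Fin d)), IsProbabilityMeasure ν ∧
      (∀ᵐ x ∂ν, ‖x‖ = ρ) ∧
      ∀ O : EuclideanSpace ℝ (Fin d) ≃ₗᵢ[ℝ] EuclideanSpace ℝ (Fin d), ν.map O = ν := by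
  have : Nonempty (Fin d) := ⟨⟨0, by omega⟩⟩
  let B : Set (EuclideanSpace ℝ (Fin d)) := Metric.ball 0 1
  let g : EuclideanSpace ℝ (Fin d) → EuclideanSpace ℝ (Fin d) := fun x => (ρ / ‖x‖) • x
  have hg : Measurable g := by fun_prop
  have hB0 : volume B ≠ 0 := (Metric.measure_ball_pos _ _ one_pos).ne'
  have hBt : volume B ≠ ⊤ := measure_ball_lt_top.ne
  let β := ProbabilityTheory.cond volume B
  have : IsProbabilityMeasure β := ProbabilityTheory.cond_isProbabilityMeasure_of_finite hB0 hBt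
  refine ⟨β.map g, Measure.isProbabilityMeasure_map hg.aemeasurable, ?_, ?_⟩
  · rw [ae_map_iff hg.aemeasurable (measurableSet_eq_fun measurable_norm measurable_const)]
    have h0 : ∀ᵐ x ∂(volume : Measure (EuclideanSpace ℝ (Fin d))), x ≠ 0 := by
      simp [ae_iff]
    have h1 : β ≪ volume := ProbabilityTheory.cond_absolutelyContinuous
    filter_upwards [h1.ae_le h0] with x hx
    simp [g, norm_smul, abs_of_nonneg hρ, hx]
  · intro O
    have hO : Measurable O := O.continuous.measurable
    have hβ : β.map O = β := by
      ext s hs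
      have hpre : O ⁻¹' B = B := by ext x; simp [B]
      rw [Measure.map_apply hO hs, ProbabilityTheory.cond_apply Metric.isOpen_ball.measurableSet,
        ProbabilityTheory.cond_apply Metric.isOpen_ball.measurableSet]
      congr 1
      change volume (B ∩ O ⁻¹' s) = volume (B ∩ s)
      conv_lhs => rw [← hpre, ← Set.preimage_inter]
      exact O.measurePreserving.measure_preimage
        (Metric.isOpen_ball.measurableSet.inter hs).nullMeasurableSet
    rw [Measure.map_map hO hg]
    have : O ∘ g = g ∘ O := by ext x; simp [g]
    rw [this, ← Measure.map_map hg hO, hβ]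

lemma min_principle (d : ℕ) (hd : 3 ≤ d) (k : ℝ) (hk : 2 * k = d - 2) (ε ρ : ℝ) (hε : 0 < ε)
    (hρ : 0 ≤ ρ) (ν : Measure (EuclideanSpace ℝ (Fin d))) [IsProbabilityMeasure ν]
    (hν : ∀ᵐ x ∂ν, ‖x‖ = ρ)
    (hO : ∀ O : EuclideanSpace ℝ (Fin d) ≃ₗᵢ[ℝ] EuclideanSpace ℝ (Fin d), ν.map O = ν)
    (y : EuclideanSpace ℝ (Fin d)) :
    ∫ x, ker d k ε (x + y) ∂ν ≤ ∫ x, ker d k ε x ∂ν := by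
  have hd' : (3 : ℝ) ≤ d := by exact_mod_cast hd
  have hk0 : 0 ≤ k := by linarith
  have : Nonempty (Fin d) := ⟨⟨0, by omega⟩⟩
  have hint : ∀ y, Integrable (fun x => ker d k ε (x + y)) ν := fun y =>
    ker_integrable d k ε hk0 hε ν (fun x => x + y) (by fun_prop)
  have hc := ker_cont d k ε hε
  obtain ⟨V, hV⟩ : ∃ V : EuclideanSpace ℝ (Fin d) → ℝ, V = fun y => ∫ x, ker d k ε (x + y) ∂ν :=
    ⟨_, rfl⟩
  have hVc : Continuous V := by
    rw [hV]
    refine continuous_of_dominated (bound := fun _ => ε ^ (-k)) (fun y => (hint y).1)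
      (fun y => Filter.Eventually.of_forall fun x => ker_norm_le d k ε hk0 hε _)
      (integrable_const _) (Filter.Eventually.of_forall fun x => ?_)
    fun_prop
  have hVr : ∀ v w, ‖v‖ = ‖w‖ → V v = V w := by
    intro v w h
    obtain ⟨O, rfl⟩ := exists_iso d v w h
    simp only [hV]
    conv_rhs => rw [← hO O]
    rw [integral_map O.continuous.aemeasurable (by fun_prop)]
    simp only [ker, ← map_add, LinearIsometryEquiv.norm_map]
  obtain ⟨x0, hx0, hmin⟩ := (isCompact_closedBall (0 : EuclideanSpace ℝ (Fin d)) ‖y‖).exists_isMinOn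
    ⟨0, by simp⟩ hVc.continuousOn
  have hx0' : ‖x0‖ ≤ ‖y‖ := by simpa using hx0
  have hm : ∀ x, ‖x‖ ≤ ‖y‖ → V x0 ≤ V x := fun x hx => hmin (by simpa using hx)
  have hgoal : V y ≤ V 0 := by
    rcases hx0'.eq_or_lt with h | h
    · rw [← hVr x0 y h]; exact hm 0 (by simp)
    exfalso
    obtain ⟨t0, ht0, hs⟩ := second_diff d hd k hk ε (ρ + ‖x0‖) hε (by positivity)
    obtain ⟨t, ht, ht2⟩ := exists_between (lt_min ht0 (sub_pos.2 h))
    have hs' := hs t ht (ht2.trans_le (min_le_left _ _))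
    have ht3 := ht2.trans_le (min_le_right _ _)
    have hi : ∀ (s : ℝ) (i : Fin d), |s| = t → V x0 ≤ V (x0 + EuclideanSpace.single i s) := by
      intro s i hst
      apply hm
      refine (norm_add_le _ _).trans ?_
      rw [EuclideanSpace.norm_single, Real.norm_eq_abs, hst]; linarith
    let F : EuclideanSpace ℝ (Fin d) → ℝ := fun x => 2 * d * ker d k ε (x + x0) -
      ∑ i, (ker d k ε (x + (x0 + EuclideanSpace.single i t))
        + ker d k ε (x + (x0 + EuclideanSpace.single i (-t))))
    have hFi2 : ∀ i ∈ (Finset.univ : Finset (Fin d)), Integrable (fun x =>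
        (ker d k ε (x + (x0 + EuclideanSpace.single i t))
        + ker d k ε (x + (x0 + EuclideanSpace.single i (-t))))) ν := 
      fun i _ => (hint _).add (hint _)
    have hFi : Integrable F ν := ((hint x0).const_mul _).sub (integrable_finsetSum _ hFi2)
    have hFpos : ∀ᵐ x ∂ν, 0 < F x := by
      filter_upwards [hν] with x hx
      have := hs' (x + x0) ((norm_add_le _ _).trans (by rw [hx]))
      simp only [F, ← add_assoc]
      linarith
    have h1 : 0 < ∫ x, F x ∂ν := by
      rw [integral_pos_iff_support_of_nonneg_ae (hFpos.mono fun x hx => hx.le) hFi]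
      rw [pos_iff_ne_zero]
      intro h0
      obtain ⟨x, h1, h2⟩ := ((measure_eq_zero_iff_ae_notMem.1 h0).and hFpos).exists
      exact h1 h2.ne'
    have h2 : ∫ x, F x ∂ν = 2 * d * V x0 - ∑ i, (V (x0 + EuclideanSpace.single i t)
        + V (x0 + EuclideanSpace.single i (-t))) := by
      simp only [F, hV]
      rw [integral_sub ((hint x0).const_mul _) (integrable_finsetSum _ hFi2),
        integral_finsetSum _ hFi2, integral_const_mul]
      congr 1
      exact Finset.sum_congr rfl fun i _ => integral_add (hint _) (hint _)
    have h3 : ∑ i : Fin d, (V x0 + V x0) ≤ ∑ i, (V (x0 + EuclideanSpace.single i t)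
        + V (x0 + EuclideanSpace.single i (-t))) :=
      Finset.sum_le_sum fun i _ => add_le_add (hi t i (abs_of_pos ht)) (hi (-t) i (by simp [abs_of_pos ht]))
    simp at h3
    linarith
  simpa [hV] using hgoal

lemma ker_ineq (d : ℕ) (hd : 3 ≤ d) (k : ℝ) (hk : 2 * k = d - 2) (ε : ℝ) (hε : 0 < ε)
    (μ : Measure (EuclideanSpace ℝ (Fin d))) [IsProbabilityMeasure μ]
    (hμ : ∀ O : EuclideanSpace ℝ (Fin d) ≃ₗᵢ[ℝ] EuclideanSpace ℝ (Fin d), μ.map O = μ)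
    (z : EuclideanSpace ℝ (Fin d)) :
    ∫ y, ker d k ε (z + y) ∂μ ≤ ker d k ε z := by
  have hd' : (3 : ℝ) ≤ d := by exact_mod_cast hd
  have hk0 : 0 ≤ k := by linarith
  have hc := ker_cont d k ε hε
  obtain ⟨ν, hνp, hν, hO⟩ := exists_sphere d hd ‖z‖ (norm_nonneg z)
  have h1 : ∀ x, ‖x‖ = ‖z‖ → ∫ y, ker d k ε (x + y) ∂μ = ∫ y, ker d k ε (z + y) ∂μ := by
    intro x hx
    obtain ⟨O, rfl⟩ := exists_iso d z x hx.symm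
    conv_lhs => rw [← hμ O]
    rw [integral_map O.continuous.aemeasurable (by fun_prop)]
    simp only [ker, ← map_add, LinearIsometryEquiv.norm_map]
  calc ∫ y, ker d k ε (z + y) ∂μ = ∫ x, ∫ y, ker d k ε (x + y) ∂μ ∂ν := by
        rw [integral_congr_ae (hν.mono h1)]; simp
    _ = ∫ y, ∫ x, ker d k ε (x + y) ∂ν ∂μ := by
        apply integral_integral_swap
        exact ker_integrable d k ε hk0 hε (ν.prod μ) (fun p => p.1 + p.2) (by fun_prop)
    _ ≤ ∫ y, (∫ x, ker d k ε x ∂ν) ∂μ := by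
        refine integral_mono ?_ (integrable_const _)
          (min_principle d hd k hk ε _ hε (norm_nonneg z) ν hν hO)
        exact (ker_integrable d k ε hk0 hε (ν.prod μ) (fun p => p.1 + p.2)
          (by fun_prop)).integral_prod_right
    _ = ∫ x, ker d k ε x ∂ν := by simp
    _ = ker d k ε z := by
        have : ∀ x, ‖x‖ = ‖z‖ → ker d k ε x = ker d k ε z := by
          intro x hx; simp [ker, hx]
        rw [integral_congr_ae (hν.mono this)]; simp

/-- One-step supermartingale estimate: if `q(z) = (max(|z|, A))^{-(d-2)}` and `Y` is an
isotropic random vector in `ℝ^d` (its law is invariant under every orthogonal map),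
then for `|z| ≥ A` one has `E[q(z + Y)] ≤ q(z)`. -/
theorem stmt1 (d : ℕ) (hd : 3 ≤ d) (A : ℝ) (hA : 0 < A)
    (q : EuclideanSpace ℝ (Fin d) → ℝ)
    (hq : ∀ z : EuclideanSpace ℝ (Fin d), q z = (max ‖z‖ A) ^ (-((d : ℝ) - 2)))
    {Ω : Type*} [MeasureSpace Ω] [IsProbabilityMeasure (ℙ : Measure Ω)]
    (Y : Ω → EuclideanSpace ℝ (Fin d)) (hYmeas : Measurable Y)
    (hiso : ∀ O : EuclideanSpace ℝ (Fin d) ≃ₗᵢ[ℝ] EuclideanSpace ℝ (Fin d),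
      Measure.map (fun ω => O (Y ω)) ℙ = Measure.map Y ℙ)
    (z : EuclideanSpace ℝ (Fin d)) (hz : A ≤ ‖z‖) :
    ∫ w, q (z + Y w) ∂(ℙ : Measure Ω) ≤ q z := by
  have hd' : (3 : ℝ) ≤ d := by exact_mod_cast hd
  obtain ⟨k, hk⟩ : ∃ k : ℝ, 2 * k = d - 2 := ⟨(d - 2) / 2, by ring⟩
  have hk0 : 0 ≤ k := by linarith
  have hq' : ∀ x, q x = (max ‖x‖ A ^ 2) ^ (-k) := by
    intro x
    have : 0 ≤ max ‖x‖ A := le_max_of_le_right hA.le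
    rw [hq, ← hk, ← Real.rpow_natCast, ← Real.rpow_mul this]
    congr 1; push_cast; ring
  have main : ∀ ε : ℝ, 0 < ε → (1 + ε / A ^ 2) ^ (-k) * ∫ w, q (z + Y w) ∂(ℙ : Measure Ω) ≤ q z := by
    intro ε hε
    have hp : IsProbabilityMeasure ((ℙ : Measure Ω).map Y) :=
      Measure.isProbabilityMeasure_map hYmeas.aemeasurable
    have h1 := ker_ineq d hd k hk ε hε ((ℙ : Measure Ω).map Y) (by
      intro O
      rw [Measure.map_map O.continuous.measurable hYmeas]
      exact hiso O) z
    have hc := ker_cont d k ε hε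
    rw [integral_map hYmeas.aemeasurable (by fun_prop)] at h1
    have h2 : ker d k ε z ≤ q z := by
      rw [hq', ker, max_eq_left hz]
      have : 0 < ‖z‖ := hA.trans_le hz
      apply Real.rpow_le_rpow_of_nonpos (by positivity) (by linarith) (by linarith)
    refine le_trans ?_ (h1.trans h2)
    rw [← integral_const_mul]
    refine integral_mono_of_nonneg (Filter.Eventually.of_forall fun w => ?_)
      (ker_integrable d k ε hk0 hε _ (fun w => z + Y w) (by fun_prop))
      (Filter.Eventually.of_forall fun w => ?_)
    · simp only [hq', Pi.zero_apply]; positivity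
    · simp only [hq', ker]
      rw [← Real.mul_rpow (by positivity) (by positivity)]
      apply Real.rpow_le_rpow_of_nonpos (by positivity) _ (by linarith)
      have a1 : ‖z + Y w‖ ^ 2 ≤ max ‖z + Y w‖ A ^ 2 := by gcongr; exact le_max_left _ _
      have a2 : A ^ 2 ≤ max ‖z + Y w‖ A ^ 2 := by gcongr; exact le_max_right _ _
      have a3 : ε / A ^ 2 * A ^ 2 = ε := by field_simp
      have a4 : ε / A ^ 2 * A ^ 2 ≤ ε / A ^ 2 * max ‖z + Y w‖ A ^ 2 := by gcongr
      linarith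
  have hlim : Filter.Tendsto (fun ε : ℝ => (1 + ε / A ^ 2) ^ (-k) * ∫ w, q (z + Y w) ∂(ℙ : Measure Ω))
      (nhdsWithin 0 (Set.Ioi 0)) (nhds (∫ w, q (z + Y w) ∂(ℙ : Measure Ω))) := by
    have : ContinuousAt (fun ε : ℝ => (1 + ε / A ^ 2) ^ (-k) * ∫ w, q (z + Y w) ∂(ℙ : Measure Ω)) 0 := by
      refine ContinuousAt.mul (ContinuousAt.rpow_const (by fun_prop) (Or.inl (by simp))) continuousAt_const
    have h := this.tendsto
    simp only [zero_div, add_zero, Real.one_rpow, one_mul] at h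
    exact h.mono_left nhdsWithin_le_nhds
  exact le_of_tendsto hlim (eventually_nhdsWithin_of_forall fun ε hε => main ε hε)
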